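/- Let m ≥ 3 and let Q be a quadratic form on ℤ^m which is invariant under permutations and invariant under even sign changes. Then the polar form of Q vanishes on vectors with disjoint supports: B_Q(y, y′) = 0 whenever y, y′ ∈ ℤ^m satisfy yᵢ = 0 or y′ᵢ = 0 for every index i. In particular, for m = 2n the restriction of Q to ℤ^{2n} = ℤⁿ ⊕ ℤⁿ is the direct sum of its restrictions to the two summands, and these two restrictions are equal (Q(y ⊕ 0) = Q(0 ⊕ y) for all y ∈ ℤⁿ). -/

import Mathlib

/-- Extension of `y : ℤⁿ` to `ℤ^m` supported in the first `n` coordinates. -/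
def firstHalf (n m : ℕ) (y : Fin n → ℤ) : Fin m → ℤ :=
  fun t => if h : (t : ℕ) < n then y ⟨t, h⟩ else 0

/-- Extension of `y : ℤⁿ` to `ℤ^m` supported in the coordinates `n, n+1, …`. -/
def secondHalf (n m : ℕ) (y : Fin n → ℤ) : Fin m → ℤ :=
  fun t => if h : n ≤ (t : ℕ) ∧ (t : ℕ) - n < n then y ⟨(t : ℕ) - n, h.2⟩ else 0

/-- The polar form of a quadratic form invariant under even sign changes vanishes on pairs of
distinct standard basis vectors. -/
theorem QuadraticMap.polar_single_single_eq_zero {m : ℕ} (hm : 3 ≤ m)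
    (Q : QuadraticMap ℤ (Fin m → ℤ) ℤ)
    (hsign : ∀ i j : Fin m, i ≠ j → ∀ y : Fin m → ℤ,
      Q (fun t => if t = i ∨ t = j then -y t else y t) = Q y)
    {i j : Fin m} (hij : i ≠ j) :
    QuadraticMap.polar Q (Pi.single i 1) (Pi.single j 1) = 0 := by
  obtain ⟨k, hki, hkj⟩ := Fin.exists_ne_and_ne_of_two_lt i j hm
  have hflip : (fun t => if t = i ∨ t = k then
        -(Pi.single i 1 + Pi.single j 1 : Fin m → ℤ) t
      else (Pi.single i 1 + Pi.single j 1 : Fin m → ℤ) t) =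
      -Pi.single i 1 + Pi.single j 1 := by
    ext t
    simp only [Pi.add_apply, Pi.neg_apply, Pi.single_apply]
    grind
  have hQ := hsign i k hki.symm (Pi.single i 1 + Pi.single j 1)
  rw [hflip] at hQ
  have hneg := QuadraticMap.polar_neg_left Q (Pi.single i 1) (Pi.single j 1)
  simp only [QuadraticMap.polar, QuadraticMap.map_neg] at hneg ⊢
  lia

/-- The polar form of a quadratic form invariant under even sign changes vanishes on vectors with
disjoint supports. -/
theorem QuadraticMap.polar_eq_zero_of_disjoint_supports {m : ℕ} (hm : 3 ≤ m)
    (Q : QuadraticMap ℤ (Fin m → ℤ) ℤ)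
    (hsign : ∀ i j : Fin m, i ≠ j → ∀ y : Fin m → ℤ,
      Q (fun t => if t = i ∨ t = j then -y t else y t) = Q y)
    {y y' : Fin m → ℤ} (hy : ∀ t, y t = 0 ∨ y' t = 0) :
    QuadraticMap.polar Q y y' = 0 := by
  rw [← QuadraticMap.polarBilin_apply_apply, pi_eq_sum_univ' y, pi_eq_sum_univ' y']
  simp only [map_sum, LinearMap.sum_apply, map_smul, LinearMap.smul_apply]
  refine Finset.sum_eq_zero fun j _ => ?_
  rw [Finset.smul_sum]
  refine Finset.sum_eq_zero fun i _ => ?_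
  obtain rfl | hij := eq_or_ne i j
  · obtain h | h := hy i <;> simp [h]
  · simp [QuadraticMap.polar_single_single_eq_zero hm Q hsign hij]

/-- The involution exchanging the two halves of `Fin (2 * n)`. -/
def swapHalves (n : ℕ) : Equiv.Perm (Fin (2 * n)) :=
  Function.Involutive.toPerm
    (fun t => if h : (t : ℕ) < n then ⟨t + n, by lia⟩ else ⟨t - n, by lia⟩)
    (fun t => by ext; grind)

theorem swapHalves_apply_val (n : ℕ) (t : Fin (2 * n)) :
    (swapHalves n t : ℕ) = if (t : ℕ) < n then (t : ℕ) + n else t - n := by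
  change ((if h : (t : ℕ) < n then ⟨t + n, _⟩ else ⟨t - n, _⟩ : Fin (2 * n)) : ℕ) = _
  split_ifs <;> rfl

theorem secondHalf_comp_swapHalves (n : ℕ) (y : Fin n → ℤ) :
    secondHalf n (2 * n) y ∘ swapHalves n = firstHalf n (2 * n) y := by
  ext t
  simp only [Function.comp_apply, secondHalf, firstHalf, swapHalves_apply_val]
  grind

/-- For `m ≥ 3`, the polar form of a quadratic form on `ℤ^m` invariant under permutations
and under even sign changes vanishes on vectors with disjoint supports.  In particular,
for `m = 2n` the restriction of `Q` to `ℤ^{2n} = ℤⁿ ⊕ ℤⁿ` is the direct sum of its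
restrictions to the two summands, and these two restrictions are equal. -/
theorem polar_vanishes_on_disjoint_supports
    {m : ℕ} (hm : 3 ≤ m) (Q : QuadraticMap ℤ (Fin m → ℤ) ℤ)
    (hperm : ∀ σ : Equiv.Perm (Fin m), ∀ y : Fin m → ℤ, Q (y ∘ σ) = Q y)
    (hsign : ∀ i j : Fin m, i ≠ j → ∀ y : Fin m → ℤ,
      Q (fun t => if t = i ∨ t = j then -y t else y t) = Q y) :
    (∀ y y' : Fin m → ℤ, (∀ t : Fin m, y t = 0 ∨ y' t = 0) →
      Q (y + y') - Q y - Q y' = 0) ∧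
    ∀ n : ℕ, m = 2 * n →
      (∀ y z : Fin n → ℤ,
        Q (firstHalf n m y + secondHalf n m z) =
          Q (firstHalf n m y) + Q (secondHalf n m z)) ∧
      (∀ y : Fin n → ℤ, Q (firstHalf n m y) = Q (secondHalf n m y)) := by
  have hdisj : ∀ y y' : Fin m → ℤ, (∀ t : Fin m, y t = 0 ∨ y' t = 0) →
      Q (y + y') - Q y - Q y' = 0 :=
    fun y y' hy => QuadraticMap.polar_eq_zero_of_disjoint_supports hm Q hsign hy
  refine ⟨hdisj, ?_⟩
  rintro n rfl
  refine ⟨fun y z => ?_, fun y => ?_⟩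
  · have := hdisj (firstHalf n (2 * n) y) (secondHalf n (2 * n) z) fun t => by
      simp only [firstHalf, secondHalf]
      grind
    lia
  · rw [← secondHalf_comp_swapHalves, hperm]
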